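/- arXiv:math/0702171 — 2 statements merged into one kernel-verified Lean document; each statement's English description precedes it below -/
import Mathlib

section
/- Let n ≥ 3, m ≥ 2, and let u be a smooth solution of Δᵐu = 0 in B₁\{0} ⊂ ℝⁿ with |u(x)| = o(|x|^{2m-n}) as |x| → 0. Then |Δ^{m-1}u(x)| = o(|x|^{2-n}) as |x| → 0. -/
open Metric Filter MeasureTheory Asymptotics
open scoped Topology

/-- Euclidean space ℝⁿ. -/
abbrev E (n : ℕ) := EuclideanSpace ℝ (Fin n)

/-- The Laplacian of a function on ℝⁿ. -/
noncomputable def lap {n : ℕ} (f : E n → ℝ) : E n → ℝ := fun x =>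
  ∑ i : Fin n, fderiv ℝ (fun y => fderiv ℝ f y (EuclideanSpace.single i 1)) x
    (EuclideanSpace.single i 1)

/-- Truncated radial weight. -/
noncomputable def phi {n : ℕ} (k : ℕ) (y : E n) : ℝ := (max 0 (1 - ‖y‖ ^ 2)) ^ k

/-- Weighted mean of `w` over the ball of radius `t`. -/
noncomputable def Mean {n : ℕ} (w : E n → ℝ) (x : E n) (k : ℕ) (t : ℝ) : ℝ :=
  ∫ y : E n, w (x + t • y) * phi k y

lemma phi_nonneg {n : ℕ} (k : ℕ) (y : E n) : 0 ≤ phi k y := by unfold phi; positivity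

lemma phi_cont {n : ℕ} (k : ℕ) : Continuous (phi k : E n → ℝ) := by unfold phi; fun_prop

lemma phi_eq_zero {n : ℕ} (k : ℕ) (hk : 1 ≤ k) (y : E n) (hy : 1 ≤ ‖y‖) : phi k y = 0 := by
  unfold phi
  rw [max_eq_left (by nlinarith)]
  exact zero_pow (by omega)

lemma phi_supp {n : ℕ} (k : ℕ) (hk : 1 ≤ k) : HasCompactSupport (phi k : E n → ℝ) := by
  apply HasCompactSupport.intro (isCompact_closedBall (0 : E n) 1)
  intro y hy
  apply phi_eq_zero k hk
  simp at hy
  exact hy.le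

lemma phi_integral_pos {n : ℕ} (k : ℕ) (hk : 1 ≤ k) : 0 < ∫ y : E n, phi k y := by
  apply (phi_cont k).integral_pos_of_hasCompactSupport_nonneg_nonzero (phi_supp k hk)
    (fun y => phi_nonneg k y) (x := 0)
  simp [phi]

lemma hasDerivAt_maxpow (k : ℕ) (hk : 1 ≤ k) (s : ℝ) :
    HasDerivAt (fun s : ℝ => (max 0 s) ^ (k + 1)) ((k + 1 : ℝ) * (max 0 s) ^ k) s := by
  rcases lt_trichotomy s 0 with h | h | h
  · have h1 : (fun s : ℝ => (max 0 s) ^ (k + 1)) =ᶠ[𝓝 s] fun _ => 0 := by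
      filter_upwards [Iio_mem_nhds h] with z hz
      rw [max_eq_left (le_of_lt hz)]; simp
    rw [max_eq_left h.le, zero_pow (by omega), mul_zero]
    exact (hasDerivAt_const s (0 : ℝ)).congr_of_eventuallyEq h1
  · subst h
    rw [max_self, zero_pow (by omega), mul_zero, hasDerivAt_iff_isLittleO_nhds_zero]
    simp only [zero_add, max_self, smul_zero, sub_zero]
    rw [zero_pow (by omega)]
    simp only [sub_zero]
    have h2 : (fun h : ℝ => (max 0 h) ^ (k + 1)) =O[𝓝 0] fun h : ℝ => h ^ (k + 1) := by
      apply IsBigO.of_bound 1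
      filter_upwards with z
      rw [one_mul, norm_pow, norm_pow]
      gcongr
      rw [Real.norm_eq_abs, Real.norm_eq_abs, abs_of_nonneg (le_max_left _ _)]
      exact max_le (abs_nonneg _) (le_abs_self _)
    refine h2.trans_isLittleO ?_
    have := isLittleO_pow_pow (𝕜 := ℝ) (m := 1) (n := k + 1) (by omega)
    simpa using this
  · have h1 : (fun s : ℝ => (max 0 s) ^ (k + 1)) =ᶠ[𝓝 s] fun s => s ^ (k + 1) := by
      filter_upwards [Ioi_mem_nhds h] with z hz
      rw [max_eq_right (le_of_lt hz)]
    rw [max_eq_right h.le]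
    have := (hasDerivAt_pow (k + 1) s).congr_of_eventuallyEq h1
    simpa using this

lemma phi_hasFDerivAt {n : ℕ} (k : ℕ) (hk : 1 ≤ k) (y : E n) :
    HasFDerivAt (phi (k + 1)) (((k + 1 : ℝ) * phi k y) • (-((2 : ℝ) • innerSL ℝ y))) y := by
  have h1 : HasFDerivAt (fun y : E n => 1 - ‖y‖ ^ 2) (-((2 : ℝ) • innerSL ℝ y)) y := by
    have := (hasStrictFDerivAt_norm_sq y).hasFDerivAt.const_sub 1
    refine this.congr_fderiv ?_
    ext; simp
  exact (hasDerivAt_maxpow k hk (1 - ‖y‖ ^ 2)).comp_hasFDerivAt y h1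

lemma phi_fderiv {n : ℕ} (k : ℕ) (hk : 1 ≤ k) (y : E n) (i : Fin n) :
    fderiv ℝ (phi (k + 1)) y (EuclideanSpace.single i 1) = -(2 * (k + 1) * (y i * phi k y)) := by
  rw [(phi_hasFDerivAt k hk y).fderiv]
  simp [EuclideanSpace.inner_single_right]
  ring

lemma dir_smooth {n : ℕ} {w : E n → ℝ} (hw : ContDiff ℝ (⊤ : ℕ∞) w) (v : E n) :
    ContDiff ℝ (⊤ : ℕ∞) (fun y => fderiv ℝ w y v) :=
  (hw.fderiv_right (m := (⊤ : ℕ∞)) (by simp)).clm_apply contDiff_const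

lemma lap_smooth {n : ℕ} {w : E n → ℝ} (hw : ContDiff ℝ (⊤ : ℕ∞) w) :
    ContDiff ℝ (⊤ : ℕ∞) (lap w) := by
  unfold lap
  exact ContDiff.sum fun i _ => dir_smooth (dir_smooth hw _) _

lemma lap_congr {n : ℕ} {f g : E n → ℝ} {x : E n} (h : f =ᶠ[𝓝 x] g) :
    lap f =ᶠ[𝓝 x] lap g := by
  filter_upwards [h.eventually_nhds] with z hz
  unfold lap
  refine Finset.sum_congr rfl fun i _ => ?_
  congr 1
  apply Filter.EventuallyEq.fderiv_eq
  filter_upwards [hz.eventually_nhds] with y hy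
  rw [Filter.EventuallyEq.fderiv_eq hy]

lemma lap_iter_congr {n : ℕ} {f g : E n → ℝ} {x : E n} (h : f =ᶠ[𝓝 x] g) (m : ℕ) :
    lap^[m] f =ᶠ[𝓝 x] lap^[m] g := by
  induction m generalizing f g with
  | zero => exact h
  | succ m ih => simpa using ih (lap_congr h)

lemma lap_supp {n : ℕ} {w : E n → ℝ} (hw : HasCompactSupport w) : HasCompactSupport (lap w) := by
  apply HasCompactSupport.intro hw
  intro x hx
  have h : w =ᶠ[𝓝 x] fun _ => 0 := notMem_tsupport_iff_eventuallyEq.1 hx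
  rw [(lap_congr h).eq_of_nhds]
  simp [lap]

lemma Mean_hasDerivAt_aux {n : ℕ} {w : E n → ℝ} (hw : ContDiff ℝ (⊤ : ℕ∞) w)
    (hs : HasCompactSupport w) (x : E n) (k : ℕ) (hk : 1 ≤ k) (t : ℝ) :
    HasDerivAt (Mean w x k) (∫ y : E n, fderiv ℝ w (x + t • y) y * phi k y) t := by
  have hdc : Continuous (fderiv ℝ w) := hw.continuous_fderiv (by simp)
  have hwc : Continuous w := hw.continuous
  have hpc := phi_cont (n := n) k
  obtain ⟨C, hC⟩ := hdc.bounded_above_of_compact_support (hs.fderiv (𝕜 := ℝ))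
  have hC0 : 0 ≤ C := (norm_nonneg _).trans (hC 0)
  refine (hasDerivAt_integral_of_dominated_loc_of_deriv_le
    (F := fun t y => w (x + t • y) * phi k y)
    (F' := fun t y => fderiv ℝ w (x + t • y) y * phi k y)
    (bound := fun y => C * phi k y) (s := Set.univ) Filter.univ_mem ?_ ?_ ?_ ?_ ?_ ?_).2
  · refine Eventually.of_forall fun t => Continuous.aestronglyMeasurable ?_
    fun_prop
  · apply Continuous.integrable_of_hasCompactSupport (by fun_prop)
    exact (phi_supp k hk).mul_left
  · apply Continuous.aestronglyMeasurable
    fun_prop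
  · refine Eventually.of_forall fun y s _ => ?_
    rw [norm_mul, Real.norm_of_nonneg (phi_nonneg k y)]
    by_cases hy : 1 ≤ ‖y‖
    · rw [phi_eq_zero k hk y hy]; simp
    · apply mul_le_mul_of_nonneg_right _ (phi_nonneg k y)
      calc ‖fderiv ℝ w (x + s • y) y‖ ≤ ‖fderiv ℝ w (x + s • y)‖ * ‖y‖ :=
            ContinuousLinearMap.le_opNorm _ _
        _ ≤ C * 1 := by
            gcongr
            · exact hC _
            · linarith
        _ = C := mul_one C
  · exact (hpc.integrable_of_hasCompactSupport (phi_supp k hk)).const_mul C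
  · refine Eventually.of_forall fun y s _ => ?_
    apply HasDerivAt.mul_const
    have h1 : HasDerivAt (fun s : ℝ => x + s • y) y s := by
      simpa using ((hasDerivAt_id s).smul_const y).const_add x
    exact ((hw.differentiable (by simp)) _).hasFDerivAt.comp_hasDerivAt s h1

lemma ibp {n : ℕ} {w : E n → ℝ} (hw : ContDiff ℝ (⊤ : ℕ∞) w)
    (x : E n) (k : ℕ) (hk : 1 ≤ k) (t : ℝ) (i : Fin n) :
    ∫ y : E n, w (x + t • y) * (y i * phi k y) =
      t / (2 * (k + 1)) *
        ∫ y : E n, fderiv ℝ w (x + t • y) (EuclideanSpace.single i 1) * phi (k + 1) y := by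
  have hdc : Continuous (fderiv ℝ w) := hw.continuous_fderiv (by simp)
  have hwc : Continuous w := hw.continuous
  have hpc := phi_cont (n := n) k
  have hpc' := phi_cont (n := n) (k + 1)
  have hyi : Continuous (fun y : E n => y i) := by fun_prop
  have hfd : ∀ y, HasFDerivAt (fun y : E n => w (x + t • y)) (t • fderiv ℝ w (x + t • y)) y := by
    intro y
    have h1 : HasFDerivAt (fun y : E n => x + t • y) (t • ContinuousLinearMap.id ℝ (E n)) y := by
      simpa using ((hasFDerivAt_id y).const_smul t).const_add x
    have h2 := ((hw.differentiable (by simp)) (x + t • y)).hasFDerivAt.comp y h1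
    refine h2.congr_fderiv ?_
    ext v; simp
  have key := integral_mul_fderiv_eq_neg_fderiv_mul_of_integrable (μ := (volume : Measure (E n)))
    (f := fun y : E n => w (x + t • y)) (g := phi (k + 1)) (v := EuclideanSpace.single i (1 : ℝ))
    ?_ ?_ ?_ (fun y _ => (hfd y).differentiableAt)
    (fun y _ => (phi_hasFDerivAt k hk y).differentiableAt)
  · simp only [phi_fderiv k hk, fun y => (hfd y).fderiv] at key
    have e1 : ∀ y : E n, w (x + t • y) * -(2 * (k + 1) * (y i * phi k y)) =
      -(2 * (k + 1)) * (w (x + t • y) * (y i * phi k y)) := fun y => by ring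
    have e2 : ∀ y : E n, (t • fderiv ℝ w (x + t • y)) (EuclideanSpace.single i 1) * phi (k + 1) y =
      t * (fderiv ℝ w (x + t • y) (EuclideanSpace.single i 1) * phi (k + 1) y) := fun y => by
        simp; ring
    simp only [e1, e2, integral_const_mul] at key
    rw [div_mul_eq_mul_div, eq_div_iff (by positivity)]
    linarith
  · simp only [fun y => (hfd y).fderiv]
    apply Continuous.integrable_of_hasCompactSupport
    · simp only [smul_apply]; fun_prop
    · exact (phi_supp (k + 1) (by omega)).mul_left
  · simp only [phi_fderiv k hk]
    apply Continuous.integrable_of_hasCompactSupport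
    · fun_prop
    · have : (fun y : E n => w (x + t • y) * -(2 * (k + 1) * (y i * phi k y))) =
        (fun y : E n => (w (x + t • y) * -(2 * (k + 1) * y i)) * phi k y) := by
          funext y; ring
      rw [this]
      exact (phi_supp k hk).mul_left
  · apply Continuous.integrable_of_hasCompactSupport (by fun_prop)
    exact (phi_supp (k + 1) (by omega)).mul_left

lemma fderiv_expand {n : ℕ} (L : E n →L[ℝ] ℝ) (y : E n) :
    L y = ∑ i, y i * L (EuclideanSpace.single i 1) := by
  have h : y = ∑ i, y i • EuclideanSpace.single i (1 : ℝ) := by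
    have := (EuclideanSpace.basisFun (Fin n) ℝ).sum_repr y
    simpa using this.symm
  conv_lhs => rw [h]
  simp [map_sum]

lemma Mean_hasDerivAt {n : ℕ} {w : E n → ℝ} (hw : ContDiff ℝ (⊤ : ℕ∞) w)
    (hs : HasCompactSupport w) (x : E n) (k : ℕ) (hk : 1 ≤ k) (t : ℝ) :
    HasDerivAt (Mean w x k) (t / (2 * (k + 1)) * Mean (lap w) x (k + 1) t) t := by
  convert Mean_hasDerivAt_aux hw hs x k hk t using 1
  have e : ∀ y : E n, fderiv ℝ w (x + t • y) y * phi k y =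
      ∑ i, fderiv ℝ w (x + t • y) (EuclideanSpace.single i 1) * (y i * phi k y) := by
    intro y
    rw [fderiv_expand (fderiv ℝ w (x + t • y)) y, Finset.sum_mul]
    exact Finset.sum_congr rfl fun i _ => by ring
  simp only [e]
  rw [integral_finsetSum]
  · have e2 : ∀ i : Fin n, _ := fun i => ibp (dir_smooth hw (EuclideanSpace.single i 1)) x k hk t i
    simp only [e2]
    rw [← Finset.mul_sum, ← integral_finsetSum]
    · congr 1
      unfold Mean lap
      simp only [Finset.sum_mul]
    · intro i _
      have := (dir_smooth (dir_smooth hw (EuclideanSpace.single i 1))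
        (EuclideanSpace.single i 1)).continuous
      have hp := phi_cont (n := n) (k + 1)
      apply Continuous.integrable_of_hasCompactSupport (by fun_prop)
      exact (phi_supp (k + 1) (by omega)).mul_left
  · intro i _
    have := (dir_smooth hw (EuclideanSpace.single i 1)).continuous
    have hp := phi_cont (n := n) k
    have hyi : Continuous (fun y : E n => y i) := by fun_prop
    apply Continuous.integrable_of_hasCompactSupport (by fun_prop)
    exact (phi_supp k hk).mul_left.mul_left

/-- Constants. -/
noncomputable def cc (n : ℕ) : ℕ → ℕ → ℝ
  | 0, k => ∫ y : E n, phi k y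
  | N + 1, k => cc n N (k + 1) / (4 * (k + 1) * (N + 1))

lemma cc_pos (n N k : ℕ) (hk : 1 ≤ k) : 0 < cc n N k := by
  induction N generalizing k with
  | zero => exact phi_integral_pos k hk
  | succ N ih =>
    have := ih (k + 1) (by omega)
    unfold cc
    positivity

lemma Mean_zero {n : ℕ} (w : E n → ℝ) (x : E n) (k : ℕ) :
    Mean w x k 0 = (∫ y : E n, phi k y) * w x := by
  simp [Mean, integral_const_mul, mul_comm]

lemma Mean_eq_zero {n : ℕ} (w : E n → ℝ) (x : E n) (k : ℕ) (hk : 1 ≤ k) (r : ℝ) (hr : 0 < r)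
    (h : ∀ z ∈ ball x r, w z = 0) (t : ℝ) (ht : t ∈ Set.Icc 0 r) : Mean w x k t = 0 := by
  unfold Mean
  rw [← integral_zero (E n) ℝ]
  congr 1
  funext y
  by_cases hy : 1 ≤ ‖y‖
  · rw [phi_eq_zero k hk y hy, mul_zero]
  · rw [h, zero_mul]
    push Not at hy
    rw [mem_ball, dist_eq_norm, add_sub_cancel_left, norm_smul, Real.norm_of_nonneg ht.1]
    have := norm_nonneg y
    nlinarith [ht.1, ht.2]

lemma Mean_poly {n : ℕ} (x : E n) (r : ℝ) (hr : 0 < r) (N : ℕ) :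
    ∀ (w : E n → ℝ) (k : ℕ), ContDiff ℝ (⊤ : ℕ∞) w → HasCompactSupport w → 1 ≤ k →
    (∀ z ∈ ball x r, lap^[N + 1] w z = 0) →
    ∃ a : ℕ → ℝ, (∀ t ∈ Set.Icc 0 r, Mean w x k t = ∑ j ∈ Finset.range (N + 1), a j * t ^ (2 * j)) ∧
      a N = cc n N k * lap^[N] w x := by
  induction N with
  | zero =>
    intro w k hw hs hk hz
    refine ⟨fun _ => Mean w x k 0, ?_, by simp [Mean_zero, cc]⟩
    intro t ht
    have hd := Mean_hasDerivAt hw hs x k hk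
    have := constant_of_has_deriv_right_zero (f := Mean w x k) (a := 0) (b := r)
      (fun s _ => (hd s).continuousAt.continuousWithinAt) (fun s hsr => ?_) t ht
    · simpa using this
    · have h := hd s
      rw [Mean_eq_zero (lap w) x (k + 1) (by omega) r hr (by simpa using hz) s
        ⟨hsr.1, hsr.2.le⟩, mul_zero] at h
      exact h.hasDerivWithinAt
  | succ N ih =>
    intro w k hw hs hk hz
    obtain ⟨b, hb, hbN⟩ := ih (lap w) (k + 1) (lap_smooth hw) (lap_supp hs) (by omega)
      (by simpa using hz)
    let a : ℕ → ℝ := fun j => match j with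
      | 0 => Mean w x k 0
      | j + 1 => b j / (4 * (k + 1) * (j + 1))
    refine ⟨a, ?_, ?_⟩
    · have hd := Mean_hasDerivAt hw hs x k hk
      have hpd : ∀ t : ℝ, HasDerivAt (fun t : ℝ => ∑ j ∈ Finset.range (N + 1 + 1), a j * t ^ (2 * j))
          (∑ j ∈ Finset.range (N + 1), t / (2 * (k + 1)) * (b j * t ^ (2 * j))) t := by
        intro t
        have h1 : HasDerivAt (fun t : ℝ => ∑ j ∈ Finset.range (N + 1 + 1), a j * t ^ (2 * j))
          (∑ j ∈ Finset.range (N + 1 + 1), a j * (((2 * j : ℕ) : ℝ) * t ^ (2 * j - 1))) t :=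
          HasDerivAt.fun_sum fun j _ => (hasDerivAt_pow (2 * j) t).const_mul (a j)
        refine h1.congr_deriv ?_
        rw [Finset.sum_range_succ']
        simp only [mul_zero, Nat.cast_zero, zero_mul, add_zero]
        refine Finset.sum_congr rfl fun j _ => ?_
        have : 2 * (j + 1) - 1 = 2 * j + 1 := by omega
        rw [this]
        simp only [a]
        push_cast
        field_simp
        ring
      intro t ht
      have := constant_of_has_deriv_right_zero
        (f := fun t => Mean w x k t - ∑ j ∈ Finset.range (N + 1 + 1), a j * t ^ (2 * j))
        (a := 0) (b := r)
        (fun s _ => ((hd s).sub (hpd s)).continuousAt.continuousWithinAt) (fun s hsr => ?_) t ht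
      · rw [Finset.sum_range_succ' (fun j => a j * 0 ^ (2 * j))] at this
        have e : ∀ j : ℕ, (0 : ℝ) ^ (2 * (j + 1)) = 0 := fun j => zero_pow (by omega)
        simp [a, e] at this
        linarith [this]
      · have h := (hd s).sub (hpd s)
        rw [hb s ⟨hsr.1, hsr.2.le⟩, Finset.mul_sum, sub_self] at h
        exact h.hasDerivWithinAt
    · simp only [a, hbN, cc, Function.iterate_succ_apply]
      ring

lemma coeff_bound (N : ℕ) : ∃ C : ℝ, 0 ≤ C ∧ ∀ (a : ℕ → ℝ) (A : ℝ),
    (∀ s ∈ Set.Icc (0 : ℝ) 1, |∑ j ∈ Finset.range (N + 1), a j * s ^ j| ≤ A) → |a N| ≤ C * A := by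
  let v : ℕ → ℝ := fun i => (i : ℝ) / (N + 1)
  have hv : Set.InjOn v (Finset.range (N + 1)) := by
    intro i _ j _ h
    simp only [v] at h
    field_simp at h
    exact_mod_cast h
  let D : ℕ → ℝ := fun i => ∏ j ∈ (Finset.range (N + 1)).erase i, (v i - v j)
  refine ⟨∑ i ∈ Finset.range (N + 1), |D i|⁻¹, Finset.sum_nonneg fun i _ => by positivity, ?_⟩
  intro a A h
  let P : Polynomial ℝ := ∑ j ∈ Finset.range (N + 1), Polynomial.C (a j) * Polynomial.X ^ j
  have hP : P.degree < (Finset.range (N + 1)).card := by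
    rw [Finset.card_range]
    refine lt_of_le_of_lt (Polynomial.degree_sum_le _ _) ?_
    rw [Finset.sup_lt_iff (WithBot.bot_lt_coe _)]
    intro j hj
    refine lt_of_le_of_lt (Polynomial.degree_C_mul_X_pow_le _ _) ?_
    exact_mod_cast Finset.mem_range.1 hj
  have key := Lagrange.coeff_eq_sum hv hP
  have h1 : P.coeff N = a N := by
    simp [P, Polynomial.finsetSum_coeff, Polynomial.coeff_X_pow]
  rw [Finset.card_range, Nat.add_sub_cancel, h1] at key
  rw [key, Finset.sum_mul]
  refine (Finset.abs_sum_le_sum_abs _ _).trans (Finset.sum_le_sum fun i hi => ?_)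
  rw [abs_div, div_eq_inv_mul]
  apply mul_le_mul_of_nonneg_left _ (by positivity)
  have := h (v i) ⟨by positivity, by
    simp only [v]; rw [div_le_one (by positivity)]
    have := Finset.mem_range.1 hi
    exact_mod_cast this.le⟩
  simpa [P, Polynomial.eval_finsetSum] using this

lemma interior_estimate (n N : ℕ) : ∃ C : ℝ, 0 ≤ C ∧ ∀ (u : E n → ℝ) (x : E n) (r A : ℝ) (U : Set (E n)),
    IsOpen U → 0 < r → closedBall x (2 * r) ⊆ U → ContDiffOn ℝ (⊤ : ℕ∞) u U →
    (∀ z ∈ U, lap^[N + 1] u z = 0) → (∀ z ∈ closedBall x r, |u z| ≤ A) →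
    |lap^[N] u x| * r ^ (2 * N) ≤ C * A := by
  obtain ⟨C, hC0, hC⟩ := coeff_bound N
  have hc := cc_pos n N 1 le_rfl
  have hI := phi_integral_pos (n := n) 1 le_rfl
  set I := ∫ y : E n, phi 1 y with hIdef
  refine ⟨C * I / cc n N 1, by positivity, ?_⟩
  intro u x r A U hU hr hsub hu hpoly hA
  let χ : ContDiffBump x := ⟨r, 2 * r, hr, by linarith⟩
  let w : E n → ℝ := fun y => χ y * u y
  have hw : ContDiff ℝ (⊤ : ℕ∞) w := by
    rw [contDiff_iff_contDiffAt]
    intro y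
    by_cases hy : y ∈ U
    · exact χ.contDiffAt.mul (hu.contDiffAt (hU.mem_nhds hy))
    · have : y ∉ tsupport χ := by rw [χ.tsupport_eq]; exact fun h => hy (hsub h)
      have h0 := notMem_tsupport_iff_eventuallyEq.1 this
      have h1 : w =ᶠ[𝓝 y] fun _ => 0 := by
        filter_upwards [h0] with z hz
        simp [w, hz]
      exact contDiffAt_const.congr_of_eventuallyEq h1
  have hs : HasCompactSupport w := χ.hasCompactSupport.mul_right
  have hwu : ∀ z ∈ ball x r, w =ᶠ[𝓝 z] u := by
    intro z hz
    filter_upwards [χ.eventuallyEq_one_of_mem_ball hz] with y hy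
    simp [w, hy]
  obtain ⟨a, ha, haN⟩ := Mean_poly x r hr N w 1 hw hs le_rfl (fun z hz => by
    rw [(lap_iter_congr (hwu z hz) (N + 1)).eq_of_nhds]
    exact hpoly z (hsub (closedBall_subset_closedBall (by linarith) (ball_subset_closedBall hz))))
  rw [(lap_iter_congr (hwu x (mem_ball_self hr)) N).eq_of_nhds] at haN
  have hbound : ∀ t ∈ Set.Icc 0 r, |Mean w x 1 t| ≤ A * I := by
    intro t ht
    unfold Mean
    rw [hIdef, ← integral_const_mul, ← Real.norm_eq_abs]
    apply norm_integral_le_of_norm_le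
    · exact ((phi_cont 1).integrable_of_hasCompactSupport (phi_supp 1 le_rfl)).const_mul A
    · refine Eventually.of_forall fun y => ?_
      rw [norm_mul, Real.norm_of_nonneg (phi_nonneg 1 y)]
      by_cases hy : 1 ≤ ‖y‖
      · rw [phi_eq_zero 1 le_rfl y hy]; simp
      · apply mul_le_mul_of_nonneg_right _ (phi_nonneg 1 y)
        push Not at hy
        have hm : x + t • y ∈ closedBall x r := by
          rw [mem_closedBall, dist_eq_norm, add_sub_cancel_left, norm_smul, Real.norm_of_nonneg ht.1]
          have := norm_nonneg y
          nlinarith [ht.1, ht.2]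
        have : w (x + t • y) = u (x + t • y) := by
          simp only [w]
          rw [χ.one_of_mem_closedBall hm, one_mul]
        rw [this]
        exact hA _ hm
  have hfin := hC (fun j => a j * r ^ (2 * j)) (A * I) (fun s hs => by
    have h := hbound (r * √s) ⟨by positivity, by
      have : √s ≤ 1 := Real.sqrt_le_one.2 hs.2
      nlinarith⟩
    rw [ha _ ⟨by positivity, by
      have : √s ≤ 1 := Real.sqrt_le_one.2 hs.2
      nlinarith⟩] at h
    refine le_of_eq_of_le (congrArg abs ?_) h
    refine Finset.sum_congr rfl fun j _ => ?_
    rw [mul_pow, pow_mul (√s), Real.sq_sqrt hs.1]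
    ring)
  simp only [haN, abs_mul, abs_of_pos hc, abs_of_pos (pow_pos hr (2 * N))] at hfin
  rw [div_mul_eq_mul_div, le_div_iff₀ hc]
  linarith

theorem littleO_iterated_laplacian (n m : ℕ) (hn : 3 ≤ n) (hm : 2 ≤ m)
    (u : E n → ℝ) (hu : ContDiffOn ℝ (⊤ : ℕ∞) u (ball 0 1 \ {0}))
    (hpoly : ∀ x ∈ ball (0 : E n) 1 \ {0}, lap^[m] u x = 0)
    (ho : u =o[𝓝[≠] (0 : E n)] fun x => ‖x‖ ^ (2 * (m : ℝ) - n)) :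
    (lap^[m - 1] u) =o[𝓝[≠] (0 : E n)] fun x => ‖x‖ ^ ((2 : ℝ) - n) := by
  obtain ⟨N, rfl⟩ : ∃ N, m = N + 1 := ⟨m - 1, by omega⟩
  rw [Nat.add_sub_cancel]
  obtain ⟨C, hC0, hC⟩ := interior_estimate n N
  set p : ℝ := 2 * ((N + 1 : ℕ) : ℝ) - n with hp
  -- comparison constant for `‖z‖ ^ p` on the ball of radius `‖x‖ / 4`
  let K : ℝ := 2 ^ |p|
  have hK : ∀ x z : E n, x ≠ 0 → z ∈ closedBall x (‖x‖ / 4) → ‖z‖ ^ p ≤ K * ‖x‖ ^ p := by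
    intro x z hx hz
    have hx0 : 0 < ‖x‖ := norm_pos_iff.2 hx
    rw [mem_closedBall, dist_eq_norm] at hz
    have h1 : ‖z‖ ≤ 2 * ‖x‖ := by
      have := norm_le_norm_add_norm_sub' z x
      linarith
    have h2 : ‖x‖ / 2 ≤ ‖z‖ := by
      have := norm_le_norm_add_norm_sub' x z
      rw [norm_sub_rev] at this
      linarith
    rcases le_total 0 p with h | h
    · calc ‖z‖ ^ p ≤ (2 * ‖x‖) ^ p := Real.rpow_le_rpow (norm_nonneg _) h1 h
        _ = K * ‖x‖ ^ p := by
          rw [Real.mul_rpow (by norm_num) hx0.le]; simp only [K, abs_of_nonneg h]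
    · calc ‖z‖ ^ p ≤ (‖x‖ / 2) ^ p := Real.rpow_le_rpow_of_nonpos (by positivity) h2 h
        _ = K * ‖x‖ ^ p := by
          rw [Real.div_rpow hx0.le (by norm_num)]; simp only [K, abs_of_nonpos h]
          rw [Real.rpow_neg (by norm_num)]; field_simp
  have hKpos : 0 < K := by positivity
  rw [isLittleO_iff]
  intro c hc
  let L : ℝ := C * K * 4 ^ (2 * N) + 1
  have hL : 0 < L := by positivity
  have hε : 0 < c / L := by positivity
  have h1 := (isLittleO_iff.1 ho) hε
  rw [eventually_nhdsWithin_iff, Metric.eventually_nhds_iff] at h1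
  obtain ⟨δ, hδ, h1⟩ := h1
  rw [eventually_nhdsWithin_iff, Metric.eventually_nhds_iff]
  refine ⟨min (δ / 2) (1 / 2), by positivity, ?_⟩
  intro x hxd hx
  have hx : x ≠ 0 := hx
  have hx0 : 0 < ‖x‖ := norm_pos_iff.2 hx
  rw [dist_zero_right, lt_min_iff] at hxd
  have hest := hC u x (‖x‖ / 4) (c / L * (K * ‖x‖ ^ p)) (ball 0 1 \ {0})
    (isOpen_ball.sdiff isClosed_singleton) (by positivity) ?_ hu hpoly ?_
  · have e : ‖x‖ ^ p = ‖x‖ ^ ((2 : ℝ) - n) * ‖x‖ ^ (2 * N) := by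
      rw [← Real.rpow_natCast, ← Real.rpow_add hx0, hp]
      congr 1
      push_cast
      ring
    rw [e, div_pow] at hest
    have hq : 0 < ‖x‖ ^ ((2 : ℝ) - n) := by positivity
    rw [Real.norm_eq_abs, Real.norm_of_nonneg hq.le]
    have hxN : 0 < ‖x‖ ^ (2 * N) := by positivity
    have h4 : (0 : ℝ) < 4 ^ (2 * N) := by positivity
    have h3 : |lap^[N] u x| * ‖x‖ ^ (2 * N) ≤
        ((C * K * 4 ^ (2 * N)) * (c / L) * ‖x‖ ^ ((2 : ℝ) - n)) * ‖x‖ ^ (2 * N) := by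
      rw [← mul_div_assoc, div_le_iff₀ h4] at hest
      linarith
    have h5 := le_of_mul_le_mul_right h3 hxN
    refine h5.trans (mul_le_mul_of_nonneg_right ?_ hq.le)
    calc (C * K * 4 ^ (2 * N)) * (c / L) ≤ L * (c / L) :=
          mul_le_mul_of_nonneg_right (by simp only [L]; linarith) hε.le
      _ = c := by field_simp
  · intro z hz
    rw [mem_closedBall, dist_eq_norm] at hz
    constructor
    · rw [mem_ball, dist_zero_right]
      have := norm_le_norm_add_norm_sub' z x
      linarith
    · rintro rfl
      rw [zero_sub, norm_neg] at hz
      linarith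
  · intro z hz
    have hz' := hK x z hx hz
    rw [mem_closedBall, dist_eq_norm] at hz
    have hz0 : z ≠ 0 := by
      rintro rfl
      rw [zero_sub, norm_neg] at hz
      linarith
    have h := h1 (y := z) (by
      rw [dist_zero_right]
      have := norm_le_norm_add_norm_sub' z x
      linarith) hz0
    rw [Real.norm_eq_abs, Real.norm_of_nonneg (by positivity)] at h
    exact h.trans (mul_le_mul_of_nonneg_left hz' hε.le)
end

section
/- Let n = 2, m ≥ 2, and let u be a smooth solution of Δᵐu = 0 in B₁\{0} ⊂ ℝ² with |u(x)| = o(|x|^{2m-2} log(1/|x|)) as |x| → 0. Then |Δ^{m-1}u(x)| = o(log(1/|x|)) as |x| → 0. -/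
open Metric Filter MeasureTheory Asymptotics
open scoped Topology

noncomputable def ee (θ : ℝ) : E 2 :=
  Real.cos θ • EuclideanSpace.single 0 1 + Real.sin θ • EuclideanSpace.single 1 1

noncomputable def ep (θ : ℝ) : E 2 :=
  (-Real.sin θ) • EuclideanSpace.single 0 1 + Real.cos θ • EuclideanSpace.single 1 1

lemma hasDerivAt_ee (θ : ℝ) : HasDerivAt ee (ep θ) θ :=
  ((Real.hasDerivAt_cos θ).smul_const _).add ((Real.hasDerivAt_sin θ).smul_const _)

lemma hasDerivAt_ep (θ : ℝ) : HasDerivAt ep (-ee θ) θ := by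
  have := ((Real.hasDerivAt_sin θ).neg.smul_const (EuclideanSpace.single 0 1 : E 2)).add
    ((Real.hasDerivAt_cos θ).smul_const (EuclideanSpace.single 1 1 : E 2))
  refine HasDerivAt.congr_deriv (f := ep) this ?_
  simp [ee]
  abel

lemma continuous_ee : Continuous ee := by unfold ee; fun_prop
lemma continuous_ep : Continuous ep := by unfold ep; fun_prop

lemma norm_ee (θ : ℝ) : ‖ee θ‖ = 1 := by
  simp [ee, EuclideanSpace.norm_eq, Fin.sum_univ_two]

lemma ep_periodic : ep (2 * Real.pi) = ep 0 := by simp [ep]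

lemma lap_eq {f : E 2 → ℝ} (hf : ContDiff ℝ (⊤ : ℕ∞) f) (y : E 2) (θ : ℝ) :
    lap f y = fderiv ℝ (fderiv ℝ f) y (ee θ) (ee θ) + fderiv ℝ (fderiv ℝ f) y (ep θ) (ep θ) := by
  have hd : Differentiable ℝ (fderiv ℝ f) :=
    (hf.fderiv_right (m := 1) (by norm_cast)).differentiable (by norm_num)
  have h : ∀ v : E 2, fderiv ℝ (fun y => fderiv ℝ f y v) y v = fderiv ℝ (fderiv ℝ f) y v v := by
    intro v
    have : HasFDerivAt (fun y => fderiv ℝ f y v) ((fderiv ℝ (fderiv ℝ f) y).flip v) y := by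
      have := (hd y).hasFDerivAt.clm_apply (hasFDerivAt_const v y)
      refine this.congr_fderiv ?_
      ext w
      simp
    rw [this.fderiv]; rfl
  simp only [lap, Fin.sum_univ_two, h, ee, ep, map_add, map_smul, add_apply,
    smul_apply, smul_eq_mul]
  have := Real.sin_sq_add_cos_sq θ
  linear_combination (-(fderiv ℝ (fderiv ℝ f) y (EuclideanSpace.single 0 1)) (EuclideanSpace.single 0 1)
   - (fderiv ℝ (fderiv ℝ f) y (EuclideanSpace.single 1 1)) (EuclideanSpace.single 1 1)) * this

lemma clm_path {V : Type*} [NormedAddCommGroup V] [NormedSpace ℝ V] {g : V → V →L[ℝ] ℝ}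
    {g' : V →L[ℝ] V →L[ℝ] ℝ} {p q : ℝ → V} {p' q' : V} {t : ℝ} (hg : HasFDerivAt g g' (p t))
    (hp : HasDerivAt p p' t) (hq : HasDerivAt q q' t) :
    HasDerivAt (fun t => g (p t) (q t)) (g' p' (q t) + g (p t) q') t :=
  (hg.comp_hasDerivAt t hp).clm_apply hq

lemma contDiff_lap {f : E 2 → ℝ} (hf : ContDiff ℝ (⊤ : ℕ∞) f) : ContDiff ℝ (⊤ : ℕ∞) (lap f) := by
  unfold lap
  refine ContDiff.sum fun i _ => ?_
  have h1 : ContDiff ℝ (⊤ : ℕ∞) (fun y => fderiv ℝ f y (EuclideanSpace.single i 1)) :=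
    (hf.fderiv_right (m := (⊤ : ℕ∞)) (by norm_cast)).clm_apply contDiff_const
  exact (h1.fderiv_right (m := (⊤ : ℕ∞)) (by norm_cast)).clm_apply contDiff_const

lemma param_deriv {F F' : ℝ → ℝ → ℝ} (hF : Continuous F.uncurry) (hF' : Continuous F'.uncurry)
    (h : ∀ r θ, HasDerivAt (fun r => F r θ) (F' r θ) r) (a b r : ℝ) :
    HasDerivAt (fun r => ∫ θ in a..b, F r θ) (∫ θ in a..b, F' r θ) r := by
  obtain ⟨C, hC⟩ := ((isCompact_closedBall r 1).prod (isCompact_uIcc (a := a) (b := b))).exists_bound_of_continuousOn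
    hF'.continuousOn
  refine (intervalIntegral.hasDerivAt_integral_of_dominated_loc_of_deriv_le (F' := F')
    (bound := fun _ => C) (closedBall_mem_nhds r one_pos) ?_ ?_ ?_ ?_ ?_ ?_).2
  · exact Eventually.of_forall fun x => (hF.comp (Continuous.prodMk_right x)).aestronglyMeasurable
  · exact (hF.comp (Continuous.prodMk_right r)).intervalIntegrable _ _
  · exact (hF'.comp (Continuous.prodMk_right r)).aestronglyMeasurable
  · exact Eventually.of_forall fun t ht x hx => hC (x, t) ⟨hx, Set.uIoc_subset_uIcc ht⟩
  · simp
  · exact Eventually.of_forall fun t ht x hx => h x t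

lemma ray_deriv (x : E 2) (r θ : ℝ) : HasDerivAt (fun r : ℝ => x + r • ee θ) (ee θ) r := by
  simpa using ((hasDerivAt_id r).smul_const (ee θ)).const_add x

lemma theta_identity {f : E 2 → ℝ} (hf : ContDiff ℝ (⊤ : ℕ∞) f) (x : E 2) (r : ℝ) :
    ∫ θ in (0:ℝ)..(2 * Real.pi), (r * fderiv ℝ (fderiv ℝ f) (x + r • ee θ) (ep θ) (ep θ)
      - fderiv ℝ f (x + r • ee θ) (ee θ)) = 0 := by
  have hd1 : ContDiff ℝ 1 (fderiv ℝ f) := (hf.fderiv_right (m := 1) (by norm_cast))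
  have hd : Differentiable ℝ (fderiv ℝ f) := hd1.differentiable (by norm_num)
  have hc2 : Continuous (fderiv ℝ (fderiv ℝ f)) := hd1.continuous_fderiv (by norm_num)
  have hee := continuous_ee
  have hep := continuous_ep
  rw [intervalIntegral.integral_eq_sub_of_hasDerivAt
    (f := fun θ => fderiv ℝ f (x + r • ee θ) (ep θ))]
  · simp [ep_periodic, ee]
  · intro θ _
    have h1 : HasDerivAt (fun θ => x + r • ee θ) (r • ep θ) θ :=
      ((hasDerivAt_ee θ).const_smul r).const_add x
    have h2 := clm_path (hd (x + r • ee θ)).hasFDerivAt h1 (hasDerivAt_ep θ)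
    refine h2.congr_deriv ?_
    rw [map_smul, smul_apply, map_neg, smul_eq_mul, sub_eq_add_neg]
  · apply Continuous.intervalIntegrable
    have hdc := hd1.continuous
    fun_prop

lemma A_deriv {f : E 2 → ℝ} (hf : ContDiff ℝ (⊤ : ℕ∞) f) (x : E 2) (r : ℝ) :
    HasDerivAt (fun r : ℝ => ∫ θ in (0:ℝ)..(2 * Real.pi), f (x + r • ee θ))
      (∫ θ in (0:ℝ)..(2 * Real.pi), fderiv ℝ f (x + r • ee θ) (ee θ)) r := by
  have hd1 : Continuous (fderiv ℝ f) := (hf.fderiv_right (m := 1) (by norm_cast)).continuous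
  have hee := continuous_ee
  have hfc := hf.continuous
  have hfd : Differentiable ℝ f := hf.differentiable (by norm_num)
  refine param_deriv (F := fun r θ => f (x + r • ee θ))
    (F' := fun r θ => fderiv ℝ f (x + r • ee θ) (ee θ)) ?_ ?_ ?_ _ _ r
  · simp only [Function.uncurry_def]; fun_prop
  · simp only [Function.uncurry_def]; fun_prop
  · intro r θ
    exact (hfd (x + r • ee θ)).hasFDerivAt.comp_hasDerivAt r (ray_deriv x r θ)

lemma B_deriv {f : E 2 → ℝ} (hf : ContDiff ℝ (⊤ : ℕ∞) f) (x : E 2) (r : ℝ) :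
    HasDerivAt (fun r : ℝ => ∫ θ in (0:ℝ)..(2 * Real.pi), r * fderiv ℝ f (x + r • ee θ) (ee θ))
      (r * ∫ θ in (0:ℝ)..(2 * Real.pi), lap f (x + r • ee θ)) r := by
  have hd1 : ContDiff ℝ 1 (fderiv ℝ f) := (hf.fderiv_right (m := 1) (by norm_cast))
  have hd : Differentiable ℝ (fderiv ℝ f) := hd1.differentiable (by norm_num)
  have hc1 := hd1.continuous
  have hc2 : Continuous (fderiv ℝ (fderiv ℝ f)) := hd1.continuous_fderiv (by norm_num)
  have hee := continuous_ee
  have hep := continuous_ep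
  have key := param_deriv (F := fun r θ => r * fderiv ℝ f (x + r • ee θ) (ee θ))
    (F' := fun r θ => fderiv ℝ f (x + r • ee θ) (ee θ) +
      r * fderiv ℝ (fderiv ℝ f) (x + r • ee θ) (ee θ) (ee θ)) 
    (by simp only [Function.uncurry_def]; fun_prop) (by simp only [Function.uncurry_def]; fun_prop)
    (by
      intro r θ
      have h2 := (hasDerivAt_id r).mul (clm_path (hd (x + r • ee θ)).hasFDerivAt
        (ray_deriv x r θ) (hasDerivAt_const r (ee θ)))
      refine h2.congr_deriv ?_
      simp) 0 (2 * Real.pi) r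
  refine key.congr_deriv (Eq.symm ?_)
  rw [← sub_eq_zero, ← intervalIntegral.integral_const_mul, ← intervalIntegral.integral_sub]
  · refine Eq.trans ?_ (theta_identity hf x r)
    congr 1
    ext θ
    rw [lap_eq hf _ θ]
    ring
  · have := (contDiff_lap hf).continuous
    apply Continuous.intervalIntegrable
    fun_prop
  · apply Continuous.intervalIntegrable
    fun_prop

noncomputable def pc : ℕ → ℝ
  | 0 => 2 * Real.pi
  | (k + 1) => pc k / (2 * (k : ℝ) + 2) ^ 2

lemma pc_pos (k : ℕ) : 0 < pc k := by
  induction k with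
  | zero => simp only [pc]; positivity
  | succ k ih => simp only [pc]; positivity

lemma eq_of_derivs {g h g' : ℝ → ℝ} {R : ℝ} (hg : ∀ r ∈ Set.Ico 0 R, HasDerivAt g (g' r) r)
    (hh : ∀ r ∈ Set.Ico 0 R, HasDerivAt h (g' r) r) (h0 : g 0 = h 0) :
    ∀ r ∈ Set.Ico 0 R, g r = h r := by
  intro r hr
  have hs : ∀ s ∈ Set.Icc 0 r, s ∈ Set.Ico 0 R := fun s hs => ⟨hs.1, hs.2.trans_lt hr.2⟩
  refine eq_of_has_deriv_right_eq (f' := g') (a := 0) (b := r)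
    (fun y hy => (hg y (hs y ⟨hy.1, hy.2.le⟩)).hasDerivWithinAt)
    (fun y hy => (hh y (hs y ⟨hy.1, hy.2.le⟩)).hasDerivWithinAt)
    (fun y hy => (hg y (hs y hy)).continuousAt.continuousWithinAt)
    (fun y hy => (hh y (hs y hy)).continuousAt.continuousWithinAt) h0 r ⟨hr.1, le_rfl⟩

lemma pizzetti (m : ℕ) : ∀ (f : E 2 → ℝ) (_ : ContDiff ℝ (⊤ : ℕ∞) f) (x : E 2) (R : ℝ)
    (_ : ∀ y ∈ ball x R, lap^[m] f y = 0), ∀ r ∈ Set.Ico 0 R,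
    ∫ θ in (0:ℝ)..(2 * Real.pi), f (x + r • ee θ) =
      ∑ k ∈ Finset.range m, pc k * r ^ (2 * k) * lap^[k] f x := by
  induction m with
  | zero =>
    intro f hf x R h r hr
    have : ∀ θ, f (x + r • ee θ) = 0 := fun θ => h _ (by
      simp [norm_smul, norm_ee, abs_of_nonneg hr.1, hr.2])
    simp [this]
  | succ m ih =>
    intro f hf x R h
    have ih' := ih (lap f) (contDiff_lap hf) x R h
    have hB : ∀ r ∈ Set.Ico 0 R,
        ∫ θ in (0:ℝ)..(2 * Real.pi), r * fderiv ℝ f (x + r • ee θ) (ee θ) =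
        ∑ k ∈ Finset.range m, pc k / (2 * (k : ℝ) + 2) * r ^ (2 * k + 2) * lap^[k + 1] f x := by
      refine eq_of_derivs (fun r hr => B_deriv hf x r) (fun r hr => ?_) (by simp)
      rw [ih' r hr, Finset.mul_sum]
      refine HasDerivAt.fun_sum fun k _ => ?_
      have := ((hasDerivAt_pow (2 * k + 2) r).const_mul (pc k / (2 * (k : ℝ) + 2))).mul_const
        (lap^[k + 1] f x)
      refine this.congr_deriv ?_
      rw [Function.iterate_succ_apply]
      rw [show 2 * k + 2 - 1 = 2 * k + 1 by omega]
      push_cast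
      have : (2 * (k:ℝ) + 2) ≠ 0 := by positivity
      field_simp
      try ring
    have hA := eq_of_derivs (R := R) (fun r hr => A_deriv hf x r)
      (h := fun r => ∑ k ∈ Finset.range (m + 1), pc k * r ^ (2 * k) * lap^[k] f x)
      (fun r hr => ?_) (by simp [Finset.sum_range_succ', pc])
    · exact hA
    have e1 : ∫ θ in (0:ℝ)..(2 * Real.pi), fderiv ℝ f (x + r • ee θ) (ee θ) =
        ∑ k ∈ Finset.range m, pc k / (2 * (k : ℝ) + 2) * r ^ (2 * k + 1) * lap^[k + 1] f x := by
      rcases eq_or_ne r 0 with rfl | hr0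
      · have := theta_identity hf x 0
        simp only [zero_mul, zero_sub, intervalIntegral.integral_neg, neg_eq_zero] at this
        rw [this]; simp
      · have := hB r hr
        rw [intervalIntegral.integral_const_mul] at this
        apply mul_left_cancel₀ hr0
        rw [this, Finset.mul_sum]
        refine Finset.sum_congr rfl fun k _ => ?_
        ring
    rw [e1]
    simp only [Finset.sum_range_succ']
    have h2 : HasDerivAt (fun r : ℝ => ∑ k ∈ Finset.range m,
        pc (k + 1) * r ^ (2 * (k + 1)) * lap^[k + 1] f x)
        (∑ k ∈ Finset.range m, pc k / (2 * (k : ℝ) + 2) * r ^ (2 * k + 1) * lap^[k + 1] f x) r := by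
      refine HasDerivAt.fun_sum fun k _ => ?_
      have := ((hasDerivAt_pow (2 * (k + 1)) r).const_mul (pc (k + 1))).mul_const
        (lap^[k + 1] f x)
      refine this.congr_deriv ?_
      have h3 : (2 * (k:ℝ) + 2) ≠ 0 := by positivity
      simp only [pc, show 2 * (k + 1) - 1 = 2 * k + 1 by omega]
      push_cast
      field_simp
      try ring
    simpa using h2.add_const (pc 0 * lap^[0] f x)

lemma lap_congr_s10 {U : Set (E 2)} (hU : IsOpen U) (k : ℕ) : ∀ {f g : E 2 → ℝ}, (∀ y ∈ U, f y = g y) →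
    ∀ y ∈ U, lap^[k] f y = lap^[k] g y := by
  induction k with
  | zero => intro f g h; exact h
  | succ k ih =>
    intro f g h
    rw [Function.iterate_succ, Function.comp]
    refine ih fun y hy => ?_
    have h0 : ∀ z ∈ U, f =ᶠ[𝓝 z] g := fun z hz => by
      filter_upwards [hU.mem_nhds hz] with w hw using h w hw
    simp only [lap]
    refine Finset.sum_congr rfl fun i _ => ?_
    have : (fun y => fderiv ℝ f y (EuclideanSpace.single i 1)) =ᶠ[𝓝 y]
        (fun y => fderiv ℝ g y (EuclideanSpace.single i 1)) := by
      filter_upwards [hU.mem_nhds hy] with w hw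
      rw [(h0 w hw).fderiv_eq]
    rw [this.fderiv_eq]

lemma est (m : ℕ) (hm : 1 ≤ m) : ∃ C : ℝ, 0 ≤ C ∧ ∀ (f : E 2 → ℝ) (_ : ContDiff ℝ (⊤ : ℕ∞) f)
    (x : E 2) (R : ℝ) (_ : 0 < R) (_ : ∀ y ∈ ball x R, lap^[m] f y = 0) (M : ℝ)
    (_ : ∀ y ∈ ball x R, |f y| ≤ M), R ^ (2 * (m - 1)) * |lap^[m - 1] f x| ≤ C * M := by
  set t : ℕ → ℝ := fun j => ((j : ℝ) + 1) / (m + 1) with ht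
  set v : ℕ → ℝ := fun j => t j ^ 2 with hv
  have htpos : ∀ j, 0 < t j := fun j => by simp only [ht]; positivity
  have hinj : Set.InjOn v (Finset.range m) := by
    intro i _ j _ hij
    have h1 : t i = t j := (pow_left_inj₀ (htpos i).le (htpos j).le two_ne_zero).1 hij
    simp only [ht] at h1
    have h2 : (m : ℝ) + 1 ≠ 0 := by positivity
    field_simp at h1
    exact_mod_cast add_right_cancel h1
  set D : ℕ → ℝ := fun i => ∏ j ∈ (Finset.range m).erase i, (v i - v j) with hD
  refine ⟨(∑ i ∈ Finset.range m, 2 * Real.pi / |D i|) / pc (m - 1), ?_, ?_⟩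
  · have := pc_pos (m - 1)
    positivity
  intro f hf x R hR h M hM
  have hpz := pizzetti m f hf x R h
  set P : Polynomial ℝ := ∑ k ∈ Finset.range m,
    Polynomial.monomial k (pc k * R ^ (2 * k) * lap^[k] f x) with hP
  have hdeg : P.degree < (Finset.range m).card := by
    rw [Finset.card_range, hP, Polynomial.degree_lt_iff_coeff_zero]
    intro k hk
    rw [Polynomial.finsetSum_coeff]
    simp only [Polynomial.coeff_monomial]
    rw [Finset.sum_ite_eq', if_neg (by simpa using hk)]
  have hco := Lagrange.coeff_eq_sum hinj hdeg
  have hc1 : P.coeff (m - 1) = pc (m - 1) * R ^ (2 * (m - 1)) * lap^[m - 1] f x := by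
    rw [hP, Polynomial.finsetSum_coeff]
    simp only [Polynomial.coeff_monomial]
    rw [Finset.sum_ite_eq' , if_pos (Finset.mem_range.2 (by omega))]
  have hev : ∀ j ∈ Finset.range m, |P.eval (v j)| ≤ 2 * Real.pi * M := by
    intro j hj
    have htj : t j < 1 := by
      have : (j : ℝ) < m := by exact_mod_cast Finset.mem_range.1 hj
      simp only [ht]
      rw [div_lt_one (by positivity)]; linarith
    have hr : t j * R ∈ Set.Ico 0 R := ⟨by have := htpos j; positivity, by nlinarith⟩
    have e : P.eval (v j) = ∫ θ in (0:ℝ)..(2 * Real.pi), f (x + (t j * R) • ee θ) := by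
      rw [hpz _ hr, hP, Polynomial.eval_finsetSum]
      refine Finset.sum_congr rfl fun k _ => ?_
      rw [Polynomial.eval_monomial, hv]
      simp only
      rw [← pow_mul, mul_pow]; ring
    rw [e]
    have := intervalIntegral.norm_integral_le_of_norm_le_const (a := (0:ℝ)) (b := 2 * Real.pi) (C := M)
      (f := fun θ => f (x + (t j * R) • ee θ)) (fun θ _ => hM _ (by
        rw [mem_ball, dist_eq_norm, add_sub_cancel_left, norm_smul, norm_ee, mul_one,
          Real.norm_of_nonneg hr.1]; exact hr.2))
    rw [sub_zero, abs_of_pos Real.two_pi_pos] at this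
    rw [← Real.norm_eq_abs]; linarith
  rw [Finset.card_range, hc1] at hco
  have hpc := pc_pos (m - 1)
  have hfin : pc (m - 1) * (R ^ (2 * (m - 1)) * |lap^[m - 1] f x|) ≤
      ∑ i ∈ Finset.range m, 2 * Real.pi / |D i| * M := by
    calc _ = |pc (m - 1) * R ^ (2 * (m - 1)) * lap^[m - 1] f x| := by
          rw [abs_mul, abs_mul, abs_of_pos hpc, abs_of_pos (by positivity : 0 < R ^ (2 * (m - 1)))]
          ring
      _ ≤ _ := by
          rw [hco]
          refine (Finset.abs_sum_le_sum_abs _ _).trans (Finset.sum_le_sum fun i hi => ?_)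
          rw [abs_div, div_mul_eq_mul_div]
          exact div_le_div_of_nonneg_right (hev i hi) (abs_nonneg _)
  rw [← Finset.sum_mul] at hfin
  rw [div_mul_eq_mul_div, le_div_iff₀ hpc]
  linarith

lemma local_est (m : ℕ) (hm : 1 ≤ m) : ∃ C : ℝ, 0 ≤ C ∧ ∀ (u : E 2 → ℝ) (x : E 2) (R : ℝ)
    (_ : 0 < R) (_ : ContDiffOn ℝ (⊤ : ℕ∞) u (ball x (2 * R)))
    (_ : ∀ y ∈ ball x R, lap^[m] u y = 0) (M : ℝ)
    (_ : ∀ y ∈ ball x R, |u y| ≤ M), R ^ (2 * (m - 1)) * |lap^[m - 1] u x| ≤ C * M := by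
  obtain ⟨C, hC, h⟩ := est m hm
  refine ⟨C, hC, fun u x R hR hu hp M hM => ?_⟩
  let b : ContDiffBump x := ⟨R, 3 / 2 * R, hR, by linarith⟩
  have hb : ∀ y ∈ ball x R, b y * u y = u y := fun y hy => by
    rw [b.one_of_mem_closedBall (ball_subset_closedBall hy), one_mul]
  have hsm : ContDiff ℝ (⊤ : ℕ∞) (fun y => b y * u y) := by
    rw [contDiff_iff_contDiffAt]
    intro y
    by_cases hy : y ∈ ball x (2 * R)
    · exact b.contDiffAt.mul (hu.contDiffAt (isOpen_ball.mem_nhds hy))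
    · have hy' : y ∈ (closedBall x (3 / 2 * R))ᶜ := by
        simp only [mem_ball, not_lt, Set.mem_compl_iff, mem_closedBall, not_le] at hy ⊢
        linarith
      have : (fun y => b y * u y) =ᶠ[𝓝 y] fun _ => 0 := by
        filter_upwards [isClosed_closedBall.isOpen_compl.mem_nhds hy'] with z hz
        simp only [Set.mem_compl_iff, mem_closedBall, not_le] at hz
        rw [b.zero_of_le_dist hz.le, zero_mul]
      exact contDiffAt_const.congr_of_eventuallyEq this
  have := h _ hsm x R hR (fun y hy => (lap_congr_s10 isOpen_ball m hb y hy).trans (hp y hy)) M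
    (fun y hy => by rw [hb y hy]; exact hM y hy)
  rwa [lap_congr_s10 isOpen_ball (m - 1) hb x (mem_ball_self hR)] at this

/-- If `Δᵐu = 0` on the punctured unit disk in ℝ² and
`|u(x)| = o(|x|^{2m-2} log(1/|x|))` as `x → 0`, then `|Δ^{m-1}u(x)| = o(log(1/|x|))`. -/
theorem littleO_iterated_laplacian_dim2 (m : ℕ) (hm : 2 ≤ m)
    (u : E 2 → ℝ) (hu : ContDiffOn ℝ (⊤ : ℕ∞) u (ball 0 1 \ {0}))
    (hpoly : ∀ x ∈ ball (0 : E 2) 1 \ {0}, lap^[m] u x = 0)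
    (ho : u =o[𝓝[≠] (0 : E 2)] fun x => ‖x‖ ^ (2 * (m : ℝ) - 2) * Real.log (1 / ‖x‖)) :
    (lap^[m - 1] u) =o[𝓝[≠] (0 : E 2)] fun x => Real.log (1 / ‖x‖) := by
  obtain ⟨C, hC, hest⟩ := local_est m (by omega)
  rw [isLittleO_iff] at ho ⊢
  intro c hc
  set K : ℝ := (C + 1) * 3 ^ (2 * (m - 1)) * 2 with hK
  have hKpos : 0 < K := by positivity
  have hε := ho (div_pos hc hKpos)
  rw [eventually_nhdsWithin_iff, Metric.eventually_nhds_iff] at hε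
  obtain ⟨δ, hδ, hε⟩ := hε
  have hpow : ∀ s : ℝ, 0 ≤ s → s ^ (2 * (m : ℝ) - 2) = s ^ (2 * (m - 1)) := by
    intro s hs
    rw [← Real.rpow_natCast]
    congr 1
    push_cast [Nat.cast_sub (show 1 ≤ m by omega)]
    ring
  rw [eventually_nhdsWithin_iff, Metric.eventually_nhds_iff]
  refine ⟨min (δ / 2) (1 / 2), by positivity, fun x hx hx0 => ?_⟩
  rw [dist_zero_right, lt_min_iff] at hx
  have hxpos : 0 < ‖x‖ := norm_pos_iff.2 hx0
  set R := ‖x‖ / 2 with hR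
  have hRpos : 0 < R := by positivity
  have hsub : ball x (2 * R) ⊆ ball 0 1 \ {0} := by
    intro y hy
    rw [mem_ball, dist_eq_norm] at hy
    constructor
    · rw [mem_ball, dist_zero_right]
      have := norm_le_norm_add_norm_sub' y x
      linarith
    · rintro rfl
      rw [zero_sub, norm_neg] at hy
      linarith
  have hsub2 : ball x R ⊆ ball x (2 * R) := ball_subset_ball (by linarith)
  set L := Real.log (1 / ‖x‖) with hL
  have hlog2 : Real.log 2 ≤ L := by
    apply Real.log_le_log two_pos
    rw [le_div_iff₀ hxpos]; linarith [hx.2]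
  have hLpos : 0 < L := lt_of_lt_of_le (Real.log_pos one_lt_two) hlog2
  have hbd : ∀ y ∈ ball x R, |u y| ≤ c / K * ((3 * R) ^ (2 * (m - 1)) * (2 * L)) := by
    intro y hy
    have hy1 := hsub (hsub2 hy)
    rw [mem_ball, dist_eq_norm] at hy
    have n1 := norm_le_norm_add_norm_sub' y x
    have n2 := norm_le_norm_add_norm_sub' x y
    rw [norm_sub_rev] at n2
    have hy0 : 0 < ‖y‖ := by linarith
    have hylt : ‖y‖ < 1 := by simpa using hy1.1
    have := hε (y := y) (by rw [dist_zero_right]; linarith [hx.1]) hy1.2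
    have hly : 0 ≤ Real.log (1 / ‖y‖) := Real.log_nonneg (by rw [le_div_iff₀ hy0]; linarith)
    rw [hpow _ hy0.le, Real.norm_eq_abs, Real.norm_of_nonneg (by positivity)] at this
    refine this.trans ?_
    have hl2 : Real.log (1 / ‖y‖) ≤ 2 * L := by
      have : Real.log (1 / ‖y‖) ≤ Real.log (2 * (1 / ‖x‖)) := by
        apply Real.log_le_log (by positivity)
        rw [mul_one_div, div_le_div_iff₀ hy0 hxpos]; linarith
      rw [Real.log_mul two_ne_zero (by positivity)] at this
      linarith
    have hy3 : ‖y‖ ≤ 3 * R := by linarith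
    gcongr
  have := hest u x R hRpos (hu.mono hsub) (fun y hy => hpoly y (hsub (hsub2 hy))) _ hbd
  rw [Real.norm_eq_abs, Real.norm_of_nonneg hLpos.le]
  have hRp : 0 < R ^ (2 * (m - 1)) := by positivity
  have e : C * (c / K * ((3 * R) ^ (2 * (m - 1)) * (2 * L))) ≤ R ^ (2 * (m - 1)) * (c * L) := by
    have : c / K * ((C + 1) * 3 ^ (2 * (m - 1)) * 2) = c := by
      rw [← hK]; field_simp
    calc _ ≤ (C + 1) * (c / K * ((3 * R) ^ (2 * (m - 1)) * (2 * L))) := by gcongr; linarith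
      _ = (c / K * ((C + 1) * 3 ^ (2 * (m - 1)) * 2)) * (R ^ (2 * (m - 1)) * L) := by
        rw [mul_pow]; ring
      _ = _ := by rw [this]; ring
  exact le_of_mul_le_mul_left (this.trans e) hRp
end
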